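/- arXiv:1203.0402 — 5 statements merged into one kernel-verified Lean document; each statement's English description precedes it below -/
import Mathlib

section
/- Let d ≥ 1 and 1 ≤ p, q, t ≤ ∞ with 1/p + 1/q ≥ 1, and define r by 1 + 1/r = 1/p + 1/q. Let f be a stationary function with f ∈ L^t_s(L^q), and let W ∈ L^p_loc(ℝ^d) be such that S := Σ_{k∈ℤ^d} ‖W‖_{L^p(Q+k)} < ∞. Then for almost every ω and almost every x ∈ ℝ^d the integral (W∗f)(ω,x) := ∫_{ℝ^d} f(ω,y) W(x−y) dy converges absolutely, the function W∗f is stationary, belongs to L^t_s(L^r), and satisfies ‖W∗f‖_{L^t_s(L^r)} ≤ C · S · ‖f‖_{L^t_s(L^q)} for a constant C depending only on the dimension d. -/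
open MeasureTheory Set
open scoped ENNReal NNReal

noncomputable section

/-- The translated cube `Q + k` where `Q = [-1/2, 1/2)^d` is the unit cube of `ℝ^d`
and `k ∈ ℤ^d`. -/
def cube (d : ℕ) (k : Fin d → ℤ) : Set (Fin d → ℝ) :=
  {x | ∀ i, x i - k i ∈ Set.Ico (-(1 / 2) : ℝ) (1 / 2)}

/-- The unit cube `Q = [-1/2, 1/2)^d`. -/
def unitCube (d : ℕ) : Set (Fin d → ℝ) := cube d 0

/-- A function `f : Ω × ℝ^d → ℂ` is stationary (with respect to the `ℤ^d`-action `τ` on `Ω`)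
if for every `k ∈ ℤ^d` one has `f(τ_k ω, x) = f(ω, x + k)` for almost every `(ω, x)`. -/
def Stationary {d : ℕ} {Ω : Type} [MeasurableSpace Ω] (P : Measure Ω)
    (τ : (Fin d → ℤ) → Ω → Ω) (f : Ω → (Fin d → ℝ) → ℂ) : Prop :=
  ∀ k : Fin d → ℤ, ∀ᵐ z ∂(P.prod (volume : Measure (Fin d → ℝ))),
    f (τ k z.1) z.2 = f z.1 (z.2 + fun i => (k i : ℝ))

/-- The mixed norm `‖f‖_{L^t_s(L^q)} = (E(‖f(·,·)‖_{L^q(Q)}^t))^{1/t}` of a stationary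
function (with the essential supremum convention when `t = ∞`). -/
def mixedNorm {d : ℕ} {Ω : Type} [MeasurableSpace Ω] (P : Measure Ω)
    (t q : ℝ≥0∞) (f : Ω → (Fin d → ℝ) → ℂ) : ℝ≥0∞ :=
  if t = ∞ then essSup (fun ω => eLpNorm (f ω) q (volume.restrict (unitCube d))) P
  else (∫⁻ ω, (eLpNorm (f ω) q (volume.restrict (unitCube d))) ^ t.toReal ∂P) ^ (1 / t.toReal)

lemma eLpNorm_ennreal_eq_lintegral {α : Type*} [MeasurableSpace α] {μ : Measure α} {p : ℝ≥0∞}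
    (hp : p ≠ 0) (hp' : p ≠ ∞) (f : α → ℝ≥0∞) :
    eLpNorm f p μ = (∫⁻ x, f x ^ p.toReal ∂μ) ^ (1 / p.toReal) := by
  simp [eLpNorm_eq_lintegral_rpow_enorm_toReal hp hp']

lemma eLpNorm_ennreal_top {α : Type*} [MeasurableSpace α] {μ : Measure α} (f : α → ℝ≥0∞) :
    eLpNorm f ∞ μ = essSup f μ := by
  simp [eLpNorm_exponent_top, eLpNormEssSup]

/-- Minkowski's inequality for countable sums of extended nonnegative functions. -/
lemma eLpNorm_tsum_le {α ι : Type*} [MeasurableSpace α] [Countable ι] {μ : Measure α} {p : ℝ≥0∞}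
    (hp : 1 ≤ p) {f : ι → α → ℝ≥0∞} (hf : ∀ i, Measurable (f i)) :
    eLpNorm (fun x => ∑' i, f i x) p μ ≤ ∑' i, eLpNorm (f i) p μ := by
  have hp0 : p ≠ 0 := (zero_lt_one.trans_le hp).ne'
  rcases eq_or_ne p ∞ with rfl | hpt
  · simp only [eLpNorm_ennreal_top]
    refine essSup_le_of_ae_le _ ?_
    have h : ∀ᵐ x ∂μ, ∀ i, f i x ≤ essSup (f i) μ := ae_all_iff.2 fun i => ENNReal.ae_le_essSup _
    filter_upwards [h] with x hx using ENNReal.tsum_le_tsum hx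
  · have hpos : 0 < p.toReal := ENNReal.toReal_pos hp0 hpt
    have hfin : ∀ s : Finset ι,
        ∫⁻ x, (∑ i ∈ s, f i x) ^ p.toReal ∂μ ≤ (∑' i, eLpNorm (f i) p μ) ^ p.toReal := by
      intro s
      have h := (eLpNorm_sum_le (μ := μ) (s := s) (f := f)
        (fun i _ => (hf i).aestronglyMeasurable) hp).trans (ENNReal.sum_le_tsum s)
      rw [eLpNorm_ennreal_eq_lintegral hp0 hpt, one_div, ENNReal.rpow_inv_le_iff hpos] at h
      simpa only [Finset.sum_apply] using h
    rw [eLpNorm_ennreal_eq_lintegral hp0 hpt, one_div, ENNReal.rpow_inv_le_iff hpos]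
    have hsup : ∀ x, (∑' i, f i x) ^ p.toReal = ⨆ s : Finset ι, (∑ i ∈ s, f i x) ^ p.toReal := by
      intro x
      rw [ENNReal.tsum_eq_iSup_sum]
      exact (ENNReal.orderIsoRpow p.toReal hpos).map_iSup _
    simp only [hsup]
    rw [lintegral_iSup_directed]
    · exact iSup_le hfin
    · exact fun s => ((Finset.measurable_sum s fun i _ => hf i).pow_const _).aemeasurable
    · refine Monotone.directed_le fun s t hst x => ?_
      exact ENNReal.rpow_le_rpow (Finset.sum_le_sum_of_subset hst) hpos.le

lemma lt_essSup_iff {α : Type*} [MeasurableSpace α] {μ : Measure α} (f : α → ℝ≥0∞) (c : ℝ≥0∞) :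
    c < essSup f μ ↔ μ {x | c < f x} ≠ 0 := by
  rw [← not_le, ← not_iff_not, not_not, not_not]
  constructor
  · intro h
    have := (ENNReal.ae_le_essSup (μ := μ) f).mono fun x hx => hx.trans h
    simpa [ae_iff] using this
  · intro h
    refine essSup_le_of_ae_le _ ?_
    simpa [Filter.EventuallyLE, ae_iff] using h

lemma measurable_eLpNorm_prod {Ω α : Type*} [MeasurableSpace Ω] [MeasurableSpace α]
    {μ : Measure α} [SFinite μ] (p : ℝ≥0∞) {f : Ω → α → ℝ≥0∞}
    (hf : Measurable (Function.uncurry f)) : Measurable fun ω => eLpNorm (f ω) p μ := by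
  rcases eq_or_ne p 0 with rfl | hp0
  · simp
  rcases eq_or_ne p ∞ with rfl | hpt
  · simp only [eLpNorm_ennreal_top]
    refine measurable_of_Ioi fun c => ?_
    simp only [preimage, mem_Ioi, lt_essSup_iff]
    exact (measurable_measure_prodMk_left (ν := μ) (hf measurableSet_Ioi : MeasurableSet
      {z : Ω × α | c < Function.uncurry f z})) (measurableSet_singleton 0).compl
  · simp only [eLpNorm_ennreal_eq_lintegral hp0 hpt]
    exact (Measurable.lintegral_prod_right' (hf.pow_const _)).pow_const _

/-- Hölder's inequality for extended nonnegative functions, including the endpoint exponents. -/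
lemma lintegral_mul_le_eLpNorm_mul_eLpNorm {α : Type*} [MeasurableSpace α] {μ : Measure α}
    {p q : ℝ≥0∞} (hpq : p⁻¹ + q⁻¹ = 1) {f g : α → ℝ≥0∞} (hf : Measurable f) (hg : Measurable g) :
    ∫⁻ x, f x * g x ∂μ ≤ eLpNorm f p μ * eLpNorm g q μ := by
  have key : ∀ {f g : α → ℝ≥0∞}, Measurable g →
      ∫⁻ x, f x * g x ∂μ ≤ eLpNorm f ∞ μ * eLpNorm g 1 μ := by
    intro f g hg
    rw [eLpNorm_ennreal_top, eLpNorm_one_eq_lintegral_enorm]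
    simp only [enorm_eq_self]
    rw [← lintegral_const_mul _ hg]
    refine lintegral_mono_ae ?_
    filter_upwards [ENNReal.ae_le_essSup f] with x hx
    gcongr
  rcases eq_or_ne p ∞ with rfl | hp
  · obtain rfl : q = 1 := by simpa using hpq
    exact key hg
  rcases eq_or_ne q ∞ with rfl | hq
  · obtain rfl : p = 1 := by simpa using hpq
    simpa only [mul_comm] using key (f := g) hf
  have : ENNReal.HolderConjugate p q := ENNReal.holderConjugate_iff.2 hpq
  have hr : p.toReal.HolderConjugate q.toReal := ENNReal.HolderConjugate.toReal_of_ne_top hp hq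
  have hp0 : p ≠ 0 := by rintro rfl; simp at hpq
  have hq0 : q ≠ 0 := by rintro rfl; simp at hpq
  rw [eLpNorm_ennreal_eq_lintegral hp0 hp, eLpNorm_ennreal_eq_lintegral hq0 hq]
  exact ENNReal.lintegral_mul_le_Lp_mul_Lq μ hr hf.aemeasurable hg.aemeasurable

/-- Young's convolution inequality for extended nonnegative functions. -/
lemma eLpNorm_lintegral_mul_sub_le {d : ℕ} {p q r : ℝ≥0∞} (hp : 1 ≤ p) (hq : 1 ≤ q)
    (hr : 1 + r⁻¹ = p⁻¹ + q⁻¹) {g h : (Fin d → ℝ) → ℝ≥0∞} (hg : Measurable g) (hh : Measurable h) :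
    eLpNorm (fun x => ∫⁻ y, g y * h (x - y)) r volume ≤
      eLpNorm g q volume * eLpNorm h p volume := by
  have hmeas : Measurable fun z : (Fin d → ℝ) × (Fin d → ℝ) => h (z.1 - z.2) :=
    hh.comp (measurable_fst.sub measurable_snd)
  rcases eq_or_ne r ∞ with rfl | hrt
  · rw [eLpNorm_ennreal_top]
    refine essSup_le_of_ae_le _ (Filter.Eventually.of_forall fun x => ?_)
    have hx : eLpNorm (fun y => h (x - y)) p volume = eLpNorm h p volume :=
      eLpNorm_comp_measurePreserving hh.aestronglyMeasurable
        (Measure.measurePreserving_sub_left volume x)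
    rw [← hx]
    refine lintegral_mul_le_eLpNorm_mul_eLpNorm ?_ hg (by fun_prop)
    simpa [add_comm] using hr.symm
  have hp0 : p ≠ 0 := (zero_lt_one.trans_le hp).ne'
  have hq0 : q ≠ 0 := (zero_lt_one.trans_le hq).ne'
  have hrinv : r⁻¹ ≠ 0 := ENNReal.inv_ne_zero.2 hrt
  have hlt : (1 : ℝ≥0∞) < p⁻¹ + q⁻¹ := by
    rw [← hr]; exact ENNReal.lt_add_right ENNReal.one_ne_top hrinv
  have hp1 : p⁻¹ ≤ 1 := ENNReal.inv_le_one.2 hp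
  have hq1 : q⁻¹ ≤ 1 := ENNReal.inv_le_one.2 hq
  have hpt : p ≠ ∞ := by
    rintro rfl; simp only [ENNReal.inv_top, zero_add] at hlt; exact absurd hlt hq1.not_gt
  have hqt : q ≠ ∞ := by
    rintro rfl; simp only [ENNReal.inv_top, add_zero] at hlt; exact absurd hlt hp1.not_gt
  have hr0 : r ≠ 0 := by
    rintro rfl
    simp only [ENNReal.inv_zero, add_top] at hr
    exact (ENNReal.add_lt_top.2 ⟨hp1.trans_lt ENNReal.one_lt_top,
      hq1.trans_lt ENNReal.one_lt_top⟩).ne hr.symm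
  rw [eLpNorm_ennreal_eq_lintegral hp0 hpt, eLpNorm_ennreal_eq_lintegral hq0 hqt,
    eLpNorm_ennreal_eq_lintegral hr0 hrt]
  have hrR : 1 + r.toReal⁻¹ = p.toReal⁻¹ + q.toReal⁻¹ := by
    have := congrArg ENNReal.toReal hr
    rwa [ENNReal.toReal_add ENNReal.one_ne_top (by simpa using hr0),
      ENNReal.toReal_add (by simpa using hp0) (by simpa using hq0), ENNReal.toReal_inv,
      ENNReal.toReal_inv, ENNReal.toReal_inv, ENNReal.toReal_one] at this
  have hp2 : 1 ≤ p.toReal := by simpa using ENNReal.toReal_mono hpt hp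
  have hq2 : 1 ≤ q.toReal := by simpa using ENNReal.toReal_mono hqt hq
  have hr2 : 0 < r.toReal := ENNReal.toReal_pos hr0 hrt
  generalize p.toReal = P at *
  generalize q.toReal = Q at *
  generalize r.toReal = R at *
  have hPi : P⁻¹ ≤ 1 := inv_le_one_of_one_le₀ hp2
  have hQi : Q⁻¹ ≤ 1 := inv_le_one_of_one_le₀ hq2
  have hP0 : 0 < P := by linarith
  have hQ0 : 0 < Q := by linarith
  have hRi : 0 < R⁻¹ := inv_pos.2 hr2
  set a := ∫⁻ y, g y ^ Q with ha
  set b := ∫⁻ y, h y ^ P with hb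
  have hpoint : ∀ x, (∫⁻ y, g y * h (x - y)) ^ R ≤
      (∫⁻ y, g y ^ Q * h (x - y) ^ P) * (a ^ ((Q⁻¹ - R⁻¹) * R) * b ^ ((P⁻¹ - R⁻¹) * R)) := by
    intro x
    have hb' : ∫⁻ y, h (x - y) ^ P = b := lintegral_sub_left_eq_self (fun y => h y ^ P) x
    have hH := ENNReal.lintegral_prod_norm_pow_le (μ := (volume : Measure (Fin d → ℝ)))
      (Finset.univ : Finset (Fin 3))
      (f := ![fun y => g y ^ Q * h (x - y) ^ P, fun y => g y ^ Q, fun y => h (x - y) ^ P])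
      (p := ![R⁻¹, Q⁻¹ - R⁻¹, P⁻¹ - R⁻¹])
      (by
        intro i _
        fin_cases i <;> simp <;> fun_prop)
      (by simp [Fin.sum_univ_three]; linarith)
      (by
        intro i _
        fin_cases i <;> simp <;> linarith)
    simp only [Fin.prod_univ_three, Matrix.cons_val_zero, Matrix.cons_val_one,
      Matrix.cons_val] at hH
    rw [hb', ← ha] at hH
    have hL : ∀ y, g y * h (x - y) = (g y ^ Q * h (x - y) ^ P) ^ R⁻¹ *
        (g y ^ Q) ^ (Q⁻¹ - R⁻¹) * (h (x - y) ^ P) ^ (P⁻¹ - R⁻¹) := by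
      intro y
      rw [ENNReal.mul_rpow_of_nonneg _ _ hRi.le, mul_assoc, mul_mul_mul_comm,
        ← ENNReal.rpow_add_of_nonneg _ _ hRi.le (by linarith),
        ← ENNReal.rpow_add_of_nonneg _ _ hRi.le (by linarith)]
      rw [add_sub_cancel, add_sub_cancel, ENNReal.rpow_rpow_inv hQ0.ne',
        ENNReal.rpow_rpow_inv hP0.ne']
    calc (∫⁻ y, g y * h (x - y)) ^ R
        ≤ ((∫⁻ y, g y ^ Q * h (x - y) ^ P) ^ R⁻¹ * a ^ (Q⁻¹ - R⁻¹) * b ^ (P⁻¹ - R⁻¹)) ^ R := by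
          simp_rw [hL]
          exact ENNReal.rpow_le_rpow hH hr2.le
      _ = _ := by
          rw [ENNReal.mul_rpow_of_nonneg _ _ hr2.le, ENNReal.mul_rpow_of_nonneg _ _ hr2.le,
            ENNReal.rpow_inv_rpow hr2.ne', ← ENNReal.rpow_mul, ← ENNReal.rpow_mul, mul_assoc]
  have hab : ∫⁻ x, ∫⁻ y, g y ^ Q * h (x - y) ^ P = a * b := by
    rw [lintegral_lintegral_swap]
    · have : ∀ y, ∫⁻ x, g y ^ Q * h (x - y) ^ P = g y ^ Q * b := by
        intro y
        rw [lintegral_const_mul _ (by fun_prop), lintegral_sub_right_eq_self (fun x => h x ^ P) y]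
      simp_rw [this]
      rw [lintegral_mul_const _ (by fun_prop)]
    · exact ((hg.comp measurable_snd).pow_const _ |>.mul (hmeas.pow_const _)).aemeasurable
  have hmain : ∫⁻ x, (∫⁻ y, g y * h (x - y)) ^ R ≤ a ^ (Q⁻¹ * R) * b ^ (P⁻¹ * R) := by
    refine (lintegral_mono hpoint).trans ?_
    rw [lintegral_mul_const _ (Measurable.lintegral_prod_right'
      (f := fun z => g z.2 ^ Q * h (z.1 - z.2) ^ P)
      ((hg.comp measurable_snd).pow_const _ |>.mul (hmeas.pow_const _))), hab, mul_mul_mul_comm]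
    have e : ∀ (c : ℝ≥0∞) (s : ℝ), R⁻¹ ≤ s → c * c ^ ((s - R⁻¹) * R) = c ^ (s * R) := by
      intro c s hs
      have h1 : s * R = 1 + (s - R⁻¹) * R := by field_simp; ring
      rw [h1, ENNReal.rpow_add_of_nonneg _ _ zero_le_one
        (mul_nonneg (by linarith) hr2.le), ENNReal.rpow_one]
    rw [e _ _ (by linarith), e _ _ (by linarith)]
  rw [one_div, ENNReal.rpow_inv_le_iff hr2, ENNReal.mul_rpow_of_nonneg _ _ hr2.le,
    ← ENNReal.rpow_mul, ← ENNReal.rpow_mul]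
  simpa only [one_div] using hmain

lemma measurableSet_cube (d : ℕ) (k : Fin d → ℤ) : MeasurableSet (cube d k) := by
  have : cube d k = ⋂ i, (fun x : Fin d → ℝ => x i - k i) ⁻¹' Ico (-(1 / 2) : ℝ) (1 / 2) := by
    ext x; simp [cube]
  rw [this]
  exact MeasurableSet.iInter fun i => measurableSet_Ico.preimage (by fun_prop)

lemma mem_cube_floor {d : ℕ} (x : Fin d → ℝ) : x ∈ cube d fun i => ⌊x i + 1 / 2⌋ := by
  intro i
  have h1 := Int.floor_le (x i + 1 / 2)
  have h2 := Int.lt_floor_add_one (x i + 1 / 2)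
  constructor <;> linarith

lemma add_mem_cube_iff {d : ℕ} (k : Fin d → ℤ) (x : Fin d → ℝ) :
    (x + fun i => (k i : ℝ)) ∈ cube d k ↔ x ∈ unitCube d := by
  simp only [cube, unitCube, mem_ofPred_eq, Pi.add_apply, add_sub_cancel_right, Pi.zero_apply,
    Int.cast_zero, sub_zero]

/-- The vectors of `ℤ^d` with entries in `{-1, 0, 1}`. -/
def cubeOffsets (d : ℕ) : Finset (Fin d → ℤ) :=
  Fintype.piFinset fun _ => Finset.Icc (-1) 1

/-- If `x` and `x - y` lie in the cubes around `n` and `k`, then `y` lies in a cube whose center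
is a neighbour of `n - k`. -/
lemma exists_mem_cube_of_sub_mem {d : ℕ} {n k : Fin d → ℤ} {x y : Fin d → ℝ}
    (hx : x ∈ cube d n) (hxy : x - y ∈ cube d k) :
    ∃ j : cubeOffsets d, y ∈ cube d (n - k + j) := by
  have hm := mem_cube_floor y
  set m : Fin d → ℤ := fun i => ⌊y i + 1 / 2⌋ with hmdef
  refine ⟨⟨m + k - n, ?_⟩, by simpa using hm⟩
  simp only [cubeOffsets, Fintype.mem_piFinset, Finset.mem_Icc]
  intro i
  obtain ⟨a1, a2⟩ := hx i
  obtain ⟨b1, b2⟩ := hxy i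
  obtain ⟨c1, c2⟩ := hm i
  simp only [Pi.sub_apply] at b1 b2
  have h1 : (-2 : ℝ) < ((m + k - n) i : ℤ) := by
    simp only [Pi.sub_apply, Pi.add_apply]; push_cast; linarith
  have h2 : (((m + k - n) i : ℤ) : ℝ) < 2 := by
    simp only [Pi.sub_apply, Pi.add_apply]; push_cast; linarith
  have h1' : (-2 : ℤ) < (m + k - n) i := by exact_mod_cast h1
  have h2' : (m + k - n) i < (2 : ℤ) := by exact_mod_cast h2
  omega

/-- Young's inequality localized to unit cubes. -/
lemma eLpNorm_lintegral_mul_sub_cube_le {d : ℕ} {p q r : ℝ≥0∞} (hp : 1 ≤ p) (hq : 1 ≤ q)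
    (hr1 : 1 ≤ r) (hr : 1 + r⁻¹ = p⁻¹ + q⁻¹) {g h : (Fin d → ℝ) → ℝ≥0∞} (hg : Measurable g)
    (hh : Measurable h) (n : Fin d → ℤ) :
    eLpNorm (fun x => ∫⁻ y, g y * h (x - y)) r (volume.restrict (cube d n)) ≤
      ∑' a : (Fin d → ℤ) × cubeOffsets d,
        eLpNorm h p (volume.restrict (cube d a.1)) *
          eLpNorm g q (volume.restrict (cube d (n - a.1 + a.2))) := by
  set u : (Fin d → ℤ) × cubeOffsets d → (Fin d → ℝ) → ℝ≥0∞ :=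
    fun a => (cube d (n - a.1 + a.2)).indicator g
  set v : (Fin d → ℤ) × cubeOffsets d → (Fin d → ℝ) → ℝ≥0∞ := fun a => (cube d a.1).indicator h
  have hu : ∀ a, Measurable (u a) := fun a => hg.indicator (measurableSet_cube _ _)
  have hv : ∀ a, Measurable (v a) := fun a => hh.indicator (measurableSet_cube _ _)
  have hpoint : ∀ x ∈ cube d n,
      ∫⁻ y, g y * h (x - y) ≤ ∑' a, ∫⁻ y, u a y * v a (x - y) := by
    intro x hx
    rw [← lintegral_tsum fun a => by
      have := hu a; have := hv a; fun_prop]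
    refine lintegral_mono fun y => ?_
    obtain ⟨k, hk⟩ : ∃ k, x - y ∈ cube d k := ⟨_, mem_cube_floor (x - y)⟩
    obtain ⟨j, hj⟩ := exists_mem_cube_of_sub_mem hx hk
    refine le_trans ?_ (ENNReal.le_tsum (f := fun a => u a y * v a (x - y)) (k, j))
    simp only [u, v, indicator_of_mem hj, indicator_of_mem hk, le_refl]
  calc eLpNorm (fun x => ∫⁻ y, g y * h (x - y)) r (volume.restrict (cube d n))
      ≤ eLpNorm (fun x => ∑' a, ∫⁻ y, u a y * v a (x - y)) r (volume.restrict (cube d n)) := by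
        refine eLpNorm_mono_enorm_ae ?_
        simpa only [enorm_eq_self] using
          ae_restrict_of_forall_mem (measurableSet_cube d n) hpoint
    _ ≤ eLpNorm (fun x => ∑' a, ∫⁻ y, u a y * v a (x - y)) r volume :=
        eLpNorm_mono_measure _ Measure.restrict_le_self
    _ ≤ ∑' a, eLpNorm (fun x => ∫⁻ y, u a y * v a (x - y)) r volume :=
        eLpNorm_tsum_le hr1 fun a => Measurable.lintegral_prod_right'
          (f := fun z : (Fin d → ℝ) × (Fin d → ℝ) => u a z.2 * v a (z.1 - z.2))
          (((hu a).comp measurable_snd).mul ((hv a).comp (measurable_fst.sub measurable_snd)))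
    _ ≤ _ := by
        refine ENNReal.tsum_le_tsum fun a => ?_
        refine (eLpNorm_lintegral_mul_sub_le hp hq hr (hu a) (hv a)).trans_eq ?_
        rw [eLpNorm_indicator_eq_eLpNorm_restrict (measurableSet_cube _ _),
          eLpNorm_indicator_eq_eLpNorm_restrict (measurableSet_cube _ _), mul_comm]

section Stationary

variable {d : ℕ} {Ω : Type} [MeasurableSpace Ω] {P : Measure Ω} {τ : (Fin d → ℤ) → Ω → Ω}
  {F : Ω → (Fin d → ℝ) → ℝ≥0∞}

/-- The mixed norm of a stationary function does not depend on the cube used to define it. -/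
lemma eLpNorm_eLpNorm_cube_eq (hτ : ∀ k, MeasurePreserving (τ k) P P)
    (hF : Measurable (Function.uncurry F))
    (hs : ∀ k : Fin d → ℤ, ∀ᵐ ω ∂P, ∀ᵐ x, F (τ k ω) x = F ω (x + fun i => (k i : ℝ)))
    (t q : ℝ≥0∞) (k : Fin d → ℤ) :
    eLpNorm (fun ω => eLpNorm (F ω) q (volume.restrict (cube d k))) t P =
      eLpNorm (fun ω => eLpNorm (F ω) q (volume.restrict (unitCube d))) t P := by
  have hmeas := measurable_eLpNorm_prod (μ := volume.restrict (unitCube d)) q hF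
  rw [← eLpNorm_comp_measurePreserving hmeas.aestronglyMeasurable (hτ k)]
  refine eLpNorm_congr_ae ?_
  filter_upwards [hs k] with ω hω
  have hmp : MeasurePreserving (fun x : Fin d → ℝ => x + fun i => (k i : ℝ))
      (volume.restrict (unitCube d)) (volume.restrict (cube d k)) := by
    have := (measurePreserving_add_right (volume : Measure (Fin d → ℝ))
      (fun i => (k i : ℝ))).restrict_preimage (measurableSet_cube d k)
    convert this using 2
    ext x
    exact (add_mem_cube_iff k x).symm
  have hFω : Measurable (F ω) := hF.comp measurable_prodMk_left
  rw [← eLpNorm_comp_measurePreserving hFω.aestronglyMeasurable hmp]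
  refine eLpNorm_congr_ae (ae_restrict_of_ae ?_)
  filter_upwards [hω] with x hx using hx.symm

lemma eLpNorm_eLpNorm_lintegral_mul_sub_le (hτ : ∀ k, MeasurePreserving (τ k) P P)
    (hF : Measurable (Function.uncurry F))
    (hs : ∀ k : Fin d → ℤ, ∀ᵐ ω ∂P, ∀ᵐ x, F (τ k ω) x = F ω (x + fun i => (k i : ℝ)))
    {p q t r : ℝ≥0∞} (hp : 1 ≤ p) (hq : 1 ≤ q) (ht : 1 ≤ t) (hr1 : 1 ≤ r)
    (hr : 1 + r⁻¹ = p⁻¹ + q⁻¹) {h : (Fin d → ℝ) → ℝ≥0∞} (hh : Measurable h) (n : Fin d → ℤ) :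
    eLpNorm (fun ω => eLpNorm (fun x => ∫⁻ y, F ω y * h (x - y)) r
        (volume.restrict (cube d n))) t P ≤
      (cubeOffsets d).card * (∑' k, eLpNorm h p (volume.restrict (cube d k))) *
        eLpNorm (fun ω => eLpNorm (F ω) q (volume.restrict (unitCube d))) t P := by
  have hmeas : ∀ k, Measurable fun ω => eLpNorm (F ω) q (volume.restrict (cube d k)) :=
    fun k => measurable_eLpNorm_prod q hF
  set M := eLpNorm (fun ω => eLpNorm (F ω) q (volume.restrict (unitCube d))) t P with hM
  calc eLpNorm (fun ω => eLpNorm (fun x => ∫⁻ y, F ω y * h (x - y)) r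
        (volume.restrict (cube d n))) t P
      ≤ eLpNorm (fun ω => ∑' a : (Fin d → ℤ) × cubeOffsets d,
          eLpNorm h p (volume.restrict (cube d a.1)) *
            eLpNorm (F ω) q (volume.restrict (cube d (n - a.1 + a.2)))) t P := by
        refine eLpNorm_mono_enorm_ae (Filter.Eventually.of_forall fun ω => ?_)
        have hFω : Measurable (F ω) := hF.comp measurable_prodMk_left
        simpa only [enorm_eq_self] using
          eLpNorm_lintegral_mul_sub_cube_le hp hq hr1 hr hFω hh n
    _ ≤ ∑' a : (Fin d → ℤ) × cubeOffsets d, eLpNorm (fun ω =>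
          eLpNorm h p (volume.restrict (cube d a.1)) *
            eLpNorm (F ω) q (volume.restrict (cube d (n - a.1 + a.2)))) t P :=
        eLpNorm_tsum_le ht fun a => (hmeas _).const_mul _
    _ ≤ ∑' a : (Fin d → ℤ) × cubeOffsets d, eLpNorm h p (volume.restrict (cube d a.1)) * M := by
        refine ENNReal.tsum_le_tsum fun a => ?_
        rw [hM, ← eLpNorm_eLpNorm_cube_eq hτ hF hs t q (n - a.1 + a.2)]
        exact eLpNorm_le_mul_eLpNorm_of_ae_le_mul'' t (hmeas _).aestronglyMeasurable
          (Filter.Eventually.of_forall fun ω => by simp only [enorm_eq_self, le_refl])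
    _ = _ := by
        rw [ENNReal.tsum_mul_right, ENNReal.tsum_prod
          (f := fun k (_ : cubeOffsets d) => eLpNorm h p (volume.restrict (cube d k)))]
        simp [ENNReal.tsum_mul_left, mul_comm]

/-- If all local mixed norms of the convolution are finite, it is finite almost everywhere. -/
lemma ae_lt_top_of_eLpNorm_eLpNorm_cube_lt_top [SFinite P] {t r : ℝ≥0∞} (ht : t ≠ 0) (hr : r ≠ 0)
    (hF : Measurable (Function.uncurry F))
    (hfin : ∀ n, eLpNorm (fun ω => eLpNorm (F ω) r (volume.restrict (cube d n))) t P < ∞) :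
    ∀ᵐ z ∂(P.prod (volume : Measure (Fin d → ℝ))), F z.1 z.2 < ∞ := by
  have aux : ∀ {α : Type} [MeasurableSpace α] {μ : Measure α} {s : ℝ≥0∞} {u : α → ℝ≥0∞},
      s ≠ 0 → Measurable u → eLpNorm u s μ < ∞ → ∀ᵐ x ∂μ, u x < ∞ := by
    intro α _ μ s u hs hu hlt
    rcases eq_or_ne s ∞ with rfl | hst
    · rw [eLpNorm_ennreal_top] at hlt
      filter_upwards [ENNReal.ae_le_essSup u] with x hx using hx.trans_lt hlt
    · have hpos := ENNReal.toReal_pos hs hst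
      rw [eLpNorm_ennreal_eq_lintegral hs hst, one_div,
        ENNReal.rpow_lt_top_iff_of_pos (inv_pos.2 hpos)] at hlt
      filter_upwards [ae_lt_top (hu.pow_const _) hlt.ne] with x hx
      exact (ENNReal.rpow_lt_top_iff_of_pos hpos).1 hx
  refine (Measure.ae_prod_iff_ae_ae (p := fun z => F z.1 z.2 < ∞)
    (hF measurableSet_Iio : MeasurableSet {z | Function.uncurry F z < ∞})).2 ?_
  have h1 : ∀ᵐ ω ∂P, ∀ n, eLpNorm (F ω) r (volume.restrict (cube d n)) < ∞ :=
    ae_all_iff.2 fun n => aux ht (measurable_eLpNorm_prod r hF) (hfin n)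
  filter_upwards [h1] with ω hω
  have h2 : ∀ᵐ x, ∀ n, x ∈ cube d n → F ω x < ∞ := ae_all_iff.2 fun n =>
    (ae_restrict_iff' (measurableSet_cube d n)).1
      (aux hr (hF.comp measurable_prodMk_left) (hω n))
  filter_upwards [h2] with x hx using hx _ (mem_cube_floor x)

/-- Convolution with a fixed kernel preserves stationarity. -/
lemma Stationary.integral_mul_sub [SFinite P] {f : Ω → (Fin d → ℝ) → ℂ}
    (hf : Stationary P τ f) (W : (Fin d → ℝ) → ℂ) :
    Stationary P τ fun ω x => ∫ y, f ω y * W (x - y) := by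
  intro k
  have h := Measure.ae_ae_of_ae_prod (hf k)
  filter_upwards [Measure.quasiMeasurePreserving_fst.ae h] with z hz
  rw [← integral_add_right_eq_self (fun y => f z.1 y * W (z.2 + (fun i => (k i : ℝ)) - y))
    fun i => (k i : ℝ)]
  refine integral_congr_ae ?_
  filter_upwards [hz] with y hy
  rw [hy, add_sub_add_right_eq_sub]

lemma mixedNorm_eq_eLpNorm {t : ℝ≥0∞} (ht : t ≠ 0) (q : ℝ≥0∞) (f : Ω → (Fin d → ℝ) → ℂ) :
    mixedNorm P t q f =
      eLpNorm (fun ω => eLpNorm (fun x => ‖f ω x‖ₑ) q (volume.restrict (unitCube d))) t P := by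
  simp only [eLpNorm_enorm]
  rw [mixedNorm]
  split_ifs with h
  · rw [h, eLpNorm_ennreal_top]
  · rw [eLpNorm_ennreal_eq_lintegral ht h]

end Stationary

/-- **Convolution of stationary functions (Young-type inequality).**
Let `d ≥ 1`, `1 ≤ p, q, t ≤ ∞` with `1/p + 1/q ≥ 1`, and define `r` by `1 + 1/r = 1/p + 1/q`.
Let `f` be a stationary function in `L^t_s(L^q)` and let `W ∈ L^p_loc(ℝ^d)` be such that
`S := Σ_{k ∈ ℤ^d} ‖W‖_{L^p(Q+k)} < ∞`.  Then for a.e. `(ω, x)` the integral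
`(W ∗ f)(ω, x) = ∫ f(ω,y) W(x-y) dy` converges absolutely, `W ∗ f` is stationary, belongs
to `L^t_s(L^r)`, and `‖W ∗ f‖_{L^t_s(L^r)} ≤ C · S · ‖f‖_{L^t_s(L^q)}` where the constant `C`
depends only on the dimension `d`. -/
theorem convolution_stationary_young (d : ℕ) (hd : 1 ≤ d) :
    ∃ C : ℝ≥0, 0 < C ∧
      ∀ (Ω : Type) [MeasurableSpace Ω] (P : Measure Ω), IsProbabilityMeasure P →
      ∀ (τ : (Fin d → ℤ) → Ω → Ω),
        (∀ k, MeasurePreserving (τ k) P P) →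
        (∀ k l, τ (k + l) = τ k ∘ τ l) →
      ∀ (p q t r : ℝ≥0∞), 1 ≤ p → 1 ≤ q → 1 ≤ t →
        1 ≤ p⁻¹ + q⁻¹ → 1 + r⁻¹ = p⁻¹ + q⁻¹ →
      ∀ (f : Ω → (Fin d → ℝ) → ℂ), Measurable (Function.uncurry f) →
        Stationary P τ f → mixedNorm P t q f < ∞ →
      ∀ (W : (Fin d → ℝ) → ℂ), Measurable W →
        (∑' k : Fin d → ℤ, eLpNorm W p (volume.restrict (cube d k))) < ∞ →
        (∀ᵐ z ∂(P.prod (volume : Measure (Fin d → ℝ))),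
            Integrable (fun y => f z.1 y * W (z.2 - y)) volume) ∧
        Stationary P τ (fun ω x => ∫ y, f ω y * W (x - y)) ∧
        mixedNorm P t r (fun ω x => ∫ y, f ω y * W (x - y)) < ∞ ∧
        mixedNorm P t r (fun ω x => ∫ y, f ω y * W (x - y)) ≤
          C * (∑' k : Fin d → ℤ, eLpNorm W p (volume.restrict (cube d k))) *
            mixedNorm P t q f := by
  refine ⟨(cubeOffsets d).card, ?_, ?_⟩
  · simp [cubeOffsets]
  intro Ω _ P _ τ hτ _ p q t r hp hq ht hpq hr f hf hs hfin W hW hS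
  have ht0 : t ≠ 0 := (zero_lt_one.trans_le ht).ne'
  have hr1 : 1 ≤ r := by
    have h : 1 + r⁻¹ ≤ 1 + 1 :=
      hr.trans_le (add_le_add (ENNReal.inv_le_one.2 hp) (ENNReal.inv_le_one.2 hq))
    exact ENNReal.inv_le_one.1 ((ENNReal.add_le_add_iff_left ENNReal.one_ne_top).1 h)
  have hr0 : r ≠ 0 := (zero_lt_one.trans_le hr1).ne'
  have hF : Measurable (Function.uncurry fun ω x => ‖f ω x‖ₑ) := hf.enorm
  have hsF : ∀ k : Fin d → ℤ, ∀ᵐ ω ∂P, ∀ᵐ x,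
      ‖f (τ k ω) x‖ₑ = ‖f ω (x + fun i => (k i : ℝ))‖ₑ := by
    intro k
    filter_upwards [Measure.ae_ae_of_ae_prod (hs k)] with ω hω
    filter_upwards [hω] with x hx using congrArg _ hx
  have hbound := eLpNorm_eLpNorm_lintegral_mul_sub_le hτ hF hsF hp hq ht hr1 hr hW.enorm
  simp only [eLpNorm_enorm W, ← mixedNorm_eq_eLpNorm (P := P) ht0 q f] at hbound
  have htop : ((cubeOffsets d).card : ℝ≥0∞) *
      (∑' k : Fin d → ℤ, eLpNorm W p (volume.restrict (cube d k))) * mixedNorm P t q f < ∞ :=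
    ENNReal.mul_lt_top (ENNReal.mul_lt_top (ENNReal.natCast_lt_top _) hS) hfin
  have hle : mixedNorm P t r (fun ω x => ∫ y, f ω y * W (x - y)) ≤ (cubeOffsets d).card *
      (∑' k : Fin d → ℤ, eLpNorm W p (volume.restrict (cube d k))) * mixedNorm P t q f := by
    refine le_trans ?_ (hbound 0)
    rw [mixedNorm_eq_eLpNorm ht0]
    refine eLpNorm_mono_enorm_ae (Filter.Eventually.of_forall fun ω => ?_)
    simp only [enorm_eq_self]
    refine eLpNorm_mono_enorm_ae (Filter.Eventually.of_forall fun x => ?_)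
    simp only [enorm_eq_self, ← enorm_mul]
    exact enorm_integral_le_lintegral_enorm _
  refine ⟨?_, hs.integral_mul_sub W, hle.trans_lt htop, by simpa using hle⟩
  have hG : Measurable (Function.uncurry fun (ω : Ω) (x : Fin d → ℝ) =>
      ∫⁻ y, ‖f ω y‖ₑ * ‖W (x - y)‖ₑ) := by
    refine Measurable.lintegral_prod_right'
      (f := fun z : (Ω × (Fin d → ℝ)) × (Fin d → ℝ) => ‖f z.1.1 z.2‖ₑ * ‖W (z.1.2 - z.2)‖ₑ) ?_
    exact (hF.comp ((measurable_fst.comp measurable_fst).prodMk measurable_snd)).mul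
      (hW.enorm.comp ((measurable_snd.comp measurable_fst).sub measurable_snd))
  filter_upwards [ae_lt_top_of_eLpNorm_eLpNorm_cube_lt_top ht0 hr0 hG
    fun n => (hbound n).trans_lt htop] with z hz
  have hfz : Measurable (f z.1) := hf.comp measurable_prodMk_left
  refine ⟨(hfz.mul (hW.comp (measurable_const.sub measurable_id))).aestronglyMeasurable, ?_⟩
  simpa only [HasFiniteIntegral, enorm_mul] using hz
end
end

section
/- Let H be a complex Hilbert space, P a bounded self-adjoint operator on H with P² = P (an orthogonal projection), and γ a bounded self-adjoint operator on H. Then one has the operator identity (1−P)(γ−P)(1−P) − P(γ−P)P − (γ−P)² = γ − γ². Consequently, the inequality P^⊥(γ−P)P^⊥ − P(γ−P)P ≥ (γ−P)², where P^⊥ = 1−P, holds in the sense of quadratic forms if and only if 0 ≤ γ ≤ 1, i.e. 0 ≤ ⟨x, γx⟩ ≤ ‖x‖² for all x ∈ H. -/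
open scoped InnerProductSpace

section

variable {H : Type*} [NormedAddCommGroup H] [InnerProductSpace ℂ H]

/-- For a symmetric operator, the quadratic form of `γ - γ²` is `⟨x, γ x⟩ - ‖γ x‖²`. -/
theorem re_inner_sub_mul_self {γ : H →L[ℂ] H} (hγ : (γ : H →ₗ[ℂ] H).IsSymmetric) (x : H) :
    (⟪x, (γ - γ * γ) x⟫_ℂ).re = (⟪x, γ x⟫_ℂ).re - ‖γ x‖ ^ 2 := by
  have hsq : ⟪x, γ (γ x)⟫_ℂ = ⟪γ x, γ x⟫_ℂ := (hγ x (γ x)).symm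
  have hnorm : (⟪γ x, γ x⟫_ℂ).re = ‖γ x‖ ^ 2 := inner_self_eq_norm_sq (𝕜 := ℂ) (γ x)
  simp only [sub_apply, mul_apply_eq_comp, inner_sub_right,
    Complex.sub_re, hsq, hnorm]

/-- For a symmetric operator, `γ² ≤ γ` as quadratic forms if and only if `0 ≤ γ ≤ 1`. -/
theorem norm_sq_apply_le_re_inner_iff {γ : H →L[ℂ] H} (hγ : (γ : H →ₗ[ℂ] H).IsSymmetric) :
    (∀ x : H, ‖γ x‖ ^ 2 ≤ (⟪x, γ x⟫_ℂ).re) ↔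
      ∀ x : H, 0 ≤ (⟪x, γ x⟫_ℂ).re ∧ (⟪x, γ x⟫_ℂ).re ≤ ‖x‖ ^ 2 := by
  refine ⟨fun h x => ⟨(sq_nonneg _).trans (h x), ?_⟩, fun h x => ?_⟩
  · have hexp : ‖x - γ x‖ ^ 2 = ‖x‖ ^ 2 - 2 * (⟪x, γ x⟫_ℂ).re + ‖γ x‖ ^ 2 :=
      norm_sub_sq (𝕜 := ℂ) x (γ x)
    linarith [h x, sq_nonneg ‖x - γ x‖]
  · have hsq : ⟪x, γ (γ x)⟫_ℂ = ⟪γ x, γ x⟫_ℂ := (hγ x (γ x)).symm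
    have hnorm : (⟪γ x, γ x⟫_ℂ).re = ‖γ x‖ ^ 2 := inner_self_eq_norm_sq (𝕜 := ℂ) (γ x)
    have hpos := (h (x - γ x)).1
    simp only [map_sub, inner_sub_left, inner_sub_right, Complex.sub_re, hsq, hnorm] at hpos
    linarith [(h (γ x)).2]

end

/-- **Algebraic identity behind the variational characterization of spectral projections.**
If `P` is an orthogonal projection (bounded self-adjoint, `P² = P`) and `γ` is a bounded
self-adjoint operator on a complex Hilbert space `H`, then
`(1-P)(γ-P)(1-P) - P(γ-P)P - (γ-P)² = γ - γ²`.  Consequently the quadratic-form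
inequality `P^⊥(γ-P)P^⊥ - P(γ-P)P ≥ (γ-P)²` holds if and only if `0 ≤ γ ≤ 1`,
i.e. `0 ≤ ⟨x, γ x⟩ ≤ ‖x‖²` for all `x ∈ H`. -/
theorem projection_density_matrix_identity
    {H : Type*} [NormedAddCommGroup H] [InnerProductSpace ℂ H] [CompleteSpace H]
    (P γ : H →L[ℂ] H) (hP : IsSelfAdjoint P) (hγ : IsSelfAdjoint γ)
    (hP2 : P * P = P) :
    ((1 - P) * (γ - P) * (1 - P) - P * (γ - P) * P - (γ - P) * (γ - P) = γ - γ * γ) ∧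
    ((∀ x : H,
        0 ≤ (⟪x, ((1 - P) * (γ - P) * (1 - P) - P * (γ - P) * P
              - (γ - P) * (γ - P)) x⟫_ℂ).re) ↔
      (∀ x : H, 0 ≤ (⟪x, γ x⟫_ℂ).re ∧ (⟪x, γ x⟫_ℂ).re ≤ ‖x‖ ^ 2)) := by
  have key : (1 - P) * (γ - P) * (1 - P) - P * (γ - P) * P - (γ - P) * (γ - P) = γ - γ * γ := by
    simp only [mul_sub, sub_mul, mul_one, one_mul, hP2, mul_assoc]
    abel
  refine ⟨key, ?_⟩
  rw [key, ← norm_sq_apply_le_re_inner_iff hγ.isSymmetric]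
  simp only [re_inner_sub_mul_self hγ.isSymmetric, sub_nonneg]
end

section
/- Let H be an n×n Hermitian matrix, λ ∈ ℝ, and let P = 1_{(−∞,λ)}(H) be the orthogonal projection onto the sum of the eigenspaces of H with eigenvalue strictly less than λ. Then for every Hermitian matrix γ with 0 ≤ γ ≤ 1 (in the sense of quadratic forms), Tr((H − λ)(γ − P)) ≥ Tr(|H − λ| (γ − P)²) ≥ 0. In particular, P minimizes γ ↦ Tr((H − λ)γ) over the set {γ Hermitian : 0 ≤ γ ≤ 1}, and a Hermitian matrix γ with 0 ≤ γ ≤ 1 is a minimizer if and only if γ = P + δ for some Hermitian δ with 0 ≤ δ ≤ 1_{{λ}}(H), where 1_{{λ}}(H) is the orthogonal projection onto the kernel of H − λ. -/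
open Matrix
open scoped ComplexOrder

namespace Matrix

variable {ι : Type*}

lemma PosSemidef.sub_mul_self [Fintype ι] [DecidableEq ι] {G : Matrix ι ι ℂ} (hG : G.PosSemidef)
    (hG' : (1 - G).PosSemidef) : (G - G * G).PosSemidef := by
  have h₁ := hG'.mul_mul_conjTranspose_same G
  have h₂ := hG.mul_mul_conjTranspose_same (1 - G)
  rw [hG.isHermitian.eq] at h₁
  rw [hG'.isHermitian.eq] at h₂
  convert h₁.add h₂ using 1
  noncomm_ring

lemma re_trace_diagonal_mul [Fintype ι] [DecidableEq ι] (d : ι → ℝ) (X : Matrix ι ι ℂ) :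
    ((diagonal (fun i => (d i : ℂ)) * X).trace).re = ∑ i, d i * (X i i).re := by
  simp [trace, diagonal_mul]

lemma IsHermitian.re_mul_self_diag [Fintype ι] {Q : Matrix ι ι ℂ} (hQ : Q.IsHermitian) (i : ι) :
    ((Q * Q) i i).re = ∑ j, Complex.normSq (Q i j) := by
  rw [mul_apply, Complex.re_sum]
  refine Finset.sum_congr rfl fun j _ => ?_
  rw [← hQ.apply j i, Complex.star_def, Complex.mul_conj, Complex.ofReal_re]

/-- The diagonal matrix of the indicator function of the set of `i` where `s` holds. -/
noncomputable def indicatorDiagonal [DecidableEq ι] (s : ι → Prop) [DecidablePred s] :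
    Matrix ι ι ℂ :=
  diagonal fun i => ((if s i then (1 : ℝ) else 0 : ℝ) : ℂ)

lemma isHermitian_indicatorDiagonal [DecidableEq ι] (s : ι → Prop) [DecidablePred s] :
    (indicatorDiagonal s).IsHermitian := by
  apply isHermitian_diagonal_of_self_adjoint
  ext i
  simp

/-- Diagonal entries of the inequality `Tr(|e| (G - P)²) ≤ Tr(e (G - P))`. -/
lemma PosSemidef.abs_mul_re_sub_sq_diag_le [Fintype ι] [DecidableEq ι]
    {G : Matrix ι ι ℂ} (hG : G.PosSemidef)
    (hG' : (1 - G).PosSemidef) (e : ι → ℝ) (i : ι) :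
    |e i| * (((G - indicatorDiagonal (e · < 0)) * (G - indicatorDiagonal (e · < 0))) i i).re ≤
      e i * ((G - indicatorDiagonal (e · < 0)) i i).re := by
  have h := (Complex.nonneg_iff.1 ((hG.sub_mul_self hG').diag_nonneg (i := i))).1
  rw [sub_apply, Complex.sub_re] at h
  rw [sub_mul, mul_sub, mul_sub]
  rcases lt_trichotomy (e i) 0 with hi | hi | hi
  · simp only [indicatorDiagonal, sub_apply, mul_diagonal, diagonal_mul, diagonal_apply_eq, hi,
      if_true, abs_of_neg hi, Complex.sub_re, Complex.ofReal_one, mul_one, one_mul,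
      Complex.one_re]
    nlinarith
  · simp [hi]
  · simp only [indicatorDiagonal, sub_apply, mul_diagonal, diagonal_mul, diagonal_apply_eq,
      hi.not_gt, if_false, abs_of_pos hi, Complex.ofReal_zero, mul_zero, zero_mul,
      sub_zero]
    nlinarith

lemma indicatorDiagonal_eq_zero_mul_lt_zero [Fintype ι] [DecidableEq ι] (e : ι → ℝ) :
    indicatorDiagonal (e · = 0) * indicatorDiagonal (e · < 0) = 0 := by
  rw [indicatorDiagonal, indicatorDiagonal, diagonal_mul_diagonal, ← diagonal_zero]
  congr 1
  ext i
  by_cases h : e i = 0 <;> simp [h]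

lemma indicatorDiagonal_mul_self [Fintype ι] [DecidableEq ι] (s : ι → Prop) [DecidablePred s] :
    indicatorDiagonal s * indicatorDiagonal s = indicatorDiagonal s := by
  rw [indicatorDiagonal, diagonal_mul_diagonal]
  congr 1
  ext i
  by_cases h : s i <;> simp [h]

/-- The equality case: if `G - P` is supported on the kernel of `e`, then it lies between `0` and
the projection onto this kernel. -/
lemma PosSemidef.sub_indicatorDiagonal [Fintype ι] [DecidableEq ι]
    {G : Matrix ι ι ℂ} (hG : G.PosSemidef)
    (hG' : (1 - G).PosSemidef) (e : ι → ℝ)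
    (h : ∀ i, e i ≠ 0 → ∀ j, (G - indicatorDiagonal (e · < 0)) i j = 0) :
    (G - indicatorDiagonal (e · < 0)).PosSemidef ∧
      (indicatorDiagonal (e · = 0) - (G - indicatorDiagonal (e · < 0))).PosSemidef := by
  set P := indicatorDiagonal (e · < 0) with hP
  set K := indicatorDiagonal (e · = 0) with hK
  have hKh : Kᴴ = K := isHermitian_indicatorDiagonal _
  have hQh : (G - P)ᴴ = G - P := hG.isHermitian.sub (isHermitian_indicatorDiagonal _)
  have hKQ : K * (G - P) = G - P := by
    ext i j
    by_cases hi : e i = 0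
    · simp [hK, indicatorDiagonal, diagonal_mul, hi]
    · rw [h i hi j, hK, indicatorDiagonal, diagonal_mul, h i hi j, mul_zero]
  have hQK : (G - P) * K = G - P := by
    have h := congrArg (fun M : Matrix ι ι ℂ => Mᴴ) hKQ
    simpa only [conjTranspose_mul, hKh, hQh] using h
  have hGP : G - P = K * G * Kᴴ := by
    rw [hKh, ← hQK]
    nth_rw 1 [← hKQ]
    rw [mul_sub, indicatorDiagonal_eq_zero_mul_lt_zero, sub_zero]
  refine ⟨hGP ▸ hG.mul_mul_conjTranspose_same K, ?_⟩
  convert hG'.mul_mul_conjTranspose_same K using 1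
  rw [mul_sub, sub_mul, ← hGP, mul_one, hKh, indicatorDiagonal_mul_self]

/-- A positive semidefinite matrix below the projection onto the kernel of `e` has vanishing
trace against `e`. -/
lemma PosSemidef.re_trace_diagonal_mul_eq_zero [Fintype ι] [DecidableEq ι]
    {D : Matrix ι ι ℂ} (hD : D.PosSemidef)
    (e : ι → ℝ) (hD' : (indicatorDiagonal (e · = 0) - D).PosSemidef) :
    ((diagonal (fun i => (e i : ℂ)) * D).trace).re = 0 := by
  rw [re_trace_diagonal_mul]
  refine Finset.sum_eq_zero fun i _ => ?_
  by_cases hi : e i = 0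
  · simp [hi]
  have h₁ := (Complex.nonneg_iff.1 (hD.diag_nonneg (i := i))).1
  have h₂ := (Complex.nonneg_iff.1 (hD'.diag_nonneg (i := i))).1
  simp [indicatorDiagonal, hi] at h₂
  rw [le_antisymm h₂ h₁, mul_zero]

/-- The variational characterization for a diagonal matrix. -/
lemma PosSemidef.variational_diagonal [Fintype ι] [DecidableEq ι]
    {G : Matrix ι ι ℂ} (hG : G.PosSemidef)
    (hG' : (1 - G).PosSemidef) (e : ι → ℝ) {E A P K : Matrix ι ι ℂ}
    (hE : E = diagonal fun i => (e i : ℂ)) (hA : A = diagonal fun i => ((|e i| : ℝ) : ℂ))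
    (hP : P = indicatorDiagonal (e · < 0)) (hK : K = indicatorDiagonal (e · = 0)) :
    ((E * (G - P)).trace.re ≥ (A * ((G - P) * (G - P))).trace.re ∧
        0 ≤ (A * ((G - P) * (G - P))).trace.re) ∧
      (E * P).trace.re ≤ (E * G).trace.re ∧
      ((E * G).trace.re = (E * P).trace.re ↔
        ∃ D : Matrix ι ι ℂ, D.PosSemidef ∧ (K - D).PosSemidef ∧ G = P + D) := by
  have hQ : (G - P).IsHermitian :=
    hG.isHermitian.sub (hP ▸ isHermitian_indicatorDiagonal _)
  have hle : (A * ((G - P) * (G - P))).trace.re ≤ (E * (G - P)).trace.re := by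
    rw [hA, hE, re_trace_diagonal_mul, re_trace_diagonal_mul, hP]
    exact Finset.sum_le_sum fun i _ => hG.abs_mul_re_sub_sq_diag_le hG' e i
  have hterm (i : ι) : 0 ≤ |e i| * (((G - P) * (G - P)) i i).re := by
    rw [hQ.re_mul_self_diag]
    exact mul_nonneg (abs_nonneg _) (Finset.sum_nonneg fun j _ => Complex.normSq_nonneg _)
  have hnonneg : 0 ≤ (A * ((G - P) * (G - P))).trace.re := by
    rw [hA, re_trace_diagonal_mul]
    exact Finset.sum_nonneg fun i _ => hterm i
  have hsub : (E * (G - P)).trace.re = (E * G).trace.re - (E * P).trace.re := by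
    rw [mul_sub, trace_sub, Complex.sub_re]
  refine ⟨⟨hle, hnonneg⟩, by linarith, fun heq => ?_, ?_⟩
  · have hzero : (A * ((G - P) * (G - P))).trace.re = 0 := by linarith
    rw [hA, re_trace_diagonal_mul, Finset.sum_eq_zero_iff_of_nonneg fun i _ => hterm i] at hzero
    have hrow : ∀ i, e i ≠ 0 → ∀ j, (G - P) i j = 0 := by
      intro i hi j
      have h := (mul_eq_zero.1 (hzero i (Finset.mem_univ i))).resolve_left (abs_ne_zero.2 hi)
      rw [hQ.re_mul_self_diag,
        Finset.sum_eq_zero_iff_of_nonneg fun j _ => Complex.normSq_nonneg _] at h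
      exact Complex.normSq_eq_zero.1 (h j (Finset.mem_univ j))
    subst hP hK
    obtain ⟨h₁, h₂⟩ := hG.sub_indicatorDiagonal hG' e hrow
    exact ⟨_, h₁, h₂, (add_sub_cancel _ _).symm⟩
  · rintro ⟨D, hD, hKD, rfl⟩
    subst hE hK
    rw [mul_add, trace_add, Complex.add_re, hD.re_trace_diagonal_mul_eq_zero e hKD, add_zero]

lemma trace_conjStarAlgAut [Fintype ι] [DecidableEq ι]
    (U : unitary (Matrix ι ι ℂ)) (X : Matrix ι ι ℂ) :
    (Unitary.conjStarAlgAut ℂ _ U X).trace = X.trace := by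
  rw [Unitary.conjStarAlgAut_apply, trace_mul_cycle, Unitary.coe_star_mul_self, one_mul]

lemma posSemidef_conjStarAlgAut_iff [Fintype ι] [DecidableEq ι]
    (U : unitary (Matrix ι ι ℂ)) (X : Matrix ι ι ℂ) :
    (Unitary.conjStarAlgAut ℂ _ U X).PosSemidef ↔ X.PosSemidef := by
  rw [Unitary.conjStarAlgAut_apply]
  exact IsUnit.posSemidef_star_right_conjugate_iff (Unitary.toUnits U).isUnit

end Matrix

/-- **Variational characterization of spectral projections (finite dimension).**
Let `H` be an `n × n` Hermitian matrix, `λ ∈ ℝ`, and `P = 1_{(-∞,λ)}(H)` the spectral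
projection onto the eigenspaces with eigenvalue `< λ` (obtained by functional calculus).
Then for every Hermitian `γ` with `0 ≤ γ ≤ 1`,
`Tr((H-λ)(γ-P)) ≥ Tr(|H-λ|(γ-P)²) ≥ 0`.  In particular `P` minimizes
`γ ↦ Tr((H-λ)γ)` over `{γ Hermitian : 0 ≤ γ ≤ 1}`, and such a `γ` is a minimizer if and
only if `γ = P + δ` for some `δ` with `0 ≤ δ ≤ 1_{{λ}}(H)`, the projection onto
`ker(H-λ)`. -/
theorem spectral_projection_variational_characterization
    (n : ℕ) (H : Matrix (Fin n) (Fin n) ℂ) (hH : H.IsHermitian) (l : ℝ) :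
    ∀ P : Matrix (Fin n) (Fin n) ℂ,
      P = hH.cfc (fun x : ℝ => if x < l then (1 : ℝ) else 0) →
    ∀ K : Matrix (Fin n) (Fin n) ℂ,
      K = hH.cfc (fun x : ℝ => if x = l then (1 : ℝ) else 0) →
    ∀ γ : Matrix (Fin n) (Fin n) ℂ, γ.PosSemidef → (1 - γ).PosSemidef →
      ((((H - (l : ℂ) • 1) * (γ - P)).trace).re ≥
          (((hH.cfc fun x : ℝ => |x - l|) * ((γ - P) * (γ - P))).trace).re ∧
        0 ≤ (((hH.cfc fun x : ℝ => |x - l|) * ((γ - P) * (γ - P))).trace).re) ∧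
      (((H - (l : ℂ) • 1) * P).trace).re ≤ (((H - (l : ℂ) • 1) * γ).trace).re ∧
      ((((H - (l : ℂ) • 1) * γ).trace).re = (((H - (l : ℂ) • 1) * P).trace).re ↔
        ∃ δ : Matrix (Fin n) (Fin n) ℂ, δ.IsHermitian ∧
          δ.PosSemidef ∧ (K - δ).PosSemidef ∧ γ = P + δ) := by
  rintro P rfl K rfl γ hγ hγ'
  set φ := Unitary.conjStarAlgAut ℂ (Matrix (Fin n) (Fin n) ℂ) hH.eigenvectorUnitary with hφ
  obtain ⟨G, rfl⟩ := EquivLike.surjective φ γ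
  have hE : H - (l : ℂ) • 1 = φ (diagonal fun i => ((hH.eigenvalues i - l : ℝ) : ℂ)) := by
    conv_lhs => rw [hH.spectral_theorem, ← map_one φ, ← map_smul, ← map_sub, smul_one_eq_diagonal,
      diagonal_sub]
    simp only [Function.comp_apply, Complex.ofReal_sub, Complex.coe_algebraMap]
    rfl
  have hcfc (f : ℝ → ℝ) : hH.cfc f = φ (diagonal fun i => (f (hH.eigenvalues i) : ℂ)) := rfl
  rw [posSemidef_conjStarAlgAut_iff] at hγ
  rw [← map_one φ, ← map_sub, posSemidef_conjStarAlgAut_iff] at hγ'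
  have hP : (diagonal fun i => ((if hH.eigenvalues i < l then (1 : ℝ) else 0 : ℝ) : ℂ)) =
      indicatorDiagonal (fun i => hH.eigenvalues i - l < 0) := by
    simp only [indicatorDiagonal, sub_neg]
  have hK : (diagonal fun i => ((if hH.eigenvalues i = l then (1 : ℝ) else 0 : ℝ) : ℂ)) =
      indicatorDiagonal (fun i => hH.eigenvalues i - l = 0) := by
    simp only [indicatorDiagonal, sub_eq_zero]
  obtain ⟨h₁, h₂, h₃⟩ := hγ.variational_diagonal hγ' (fun i => hH.eigenvalues i - l) rfl rfl hP hK
  simp only [hE, hcfc, ← map_sub, ← map_mul, hφ, trace_conjStarAlgAut]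
  refine ⟨h₁, h₂, h₃.trans ⟨?_, ?_⟩⟩
  · rintro ⟨D, hD, hKD, rfl⟩
    have hφD := (posSemidef_conjStarAlgAut_iff hH.eigenvectorUnitary D).2 hD
    refine ⟨φ D, hφD.isHermitian, hφD, ?_, map_add φ _ _⟩
    rwa [← map_sub, posSemidef_conjStarAlgAut_iff]
  · rintro ⟨δ, -, hδ, hKδ, hG⟩
    obtain ⟨D, rfl⟩ := EquivLike.surjective φ δ
    rw [posSemidef_conjStarAlgAut_iff] at hδ
    rw [← map_sub, posSemidef_conjStarAlgAut_iff] at hKδ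
    exact ⟨D, hδ, hKδ, EquivLike.injective φ (hG.trans (map_add φ _ _).symm)⟩
end

section
/- Let ρ : ℝ → [0, ∞) be a measurable integrable function with N := ∫_ℝ ρ(x) dx > 0. Define F(x) = ∫_{−∞}^{x} ρ(t) dt and, for each j ∈ ℤ, φ_j(x) = √(ρ(x)/N) · exp( (2πi j / N) F(x) ). Then the family (φ_j)_{j∈ℤ} is orthonormal in L²(ℝ): ⟨φ_j, φ_l⟩_{L²(ℝ)} = δ_{jl} for all j, l ∈ ℤ. -/
open MeasureTheory

open ProbabilityTheory Set Filter Topology in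
lemma continuous_cdf (μ : Measure ℝ) [IsProbabilityMeasure μ] [NullSingletonClass μ] :
    Continuous (cdf μ) := by
  refine continuous_iff_continuousAt.2 fun a ↦ ?_
  rw [(monotone_cdf μ).continuousAt_iff_leftLim_eq_rightLim, (cdf μ).rightLim_eq]
  have h := (cdf μ).measure_singleton a
  rw [measure_cdf, measure_singleton, eq_comm, ENNReal.ofReal_eq_zero, sub_nonpos] at h
  exact le_antisymm ((monotone_cdf μ).leftLim_le le_rfl) h

open ProbabilityTheory Set Filter Topology in
/-- The probability integral transform: an atomless probability measure on `ℝ` is mapped by its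
cumulative distribution function to the uniform distribution on `[0, 1]`. -/
lemma map_cdf_eq_restrict_volume (μ : Measure ℝ) [IsProbabilityMeasure μ]
    [NullSingletonClass μ] : μ.map (cdf μ) = volume.restrict (Ioc 0 1) := by
  have hc := continuous_cdf μ
  have : IsFiniteMeasure (μ.map (cdf μ)) := Measure.isFiniteMeasure_map _ _
  refine Measure.ext_of_Iic _ _ fun t ↦ ?_
  rw [Measure.map_apply hc.measurable measurableSet_Iic, Measure.restrict_apply measurableSet_Iic,
    inter_comm, Ioc_inter_Iic, Real.volume_Ioc, sub_zero]
  rcases le_or_gt 1 t with ht1 | ht1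
  · have : cdf μ ⁻¹' Iic t = univ := eq_univ_of_forall fun x ↦ (cdf_le_one μ x).trans ht1
    simp [this, ht1]
  rw [min_eq_right ht1.le]
  have hrange (h0 : 0 < t) : t ∈ range (cdf μ) :=
    mem_range_of_exists_le_of_exists_ge hc
      ((tendsto_cdf_atBot μ).eventually (eventually_le_nhds h0)).exists
      ((tendsto_cdf_atTop μ).eventually (eventually_ge_nhds ht1)).exists
  rcases (cdf μ ⁻¹' Iic t).eq_empty_or_nonempty with he | hne
  · have ht0 : t ≤ 0 := by
      by_contra! h0
      obtain ⟨x, hx⟩ := hrange h0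
      exact he.subset (show x ∈ cdf μ ⁻¹' Iic t from hx.le)
    rw [he, measure_empty, ENNReal.ofReal_of_nonpos ht0]
  obtain ⟨b, hb⟩ := ((tendsto_cdf_atTop μ).eventually (eventually_gt_nhds ht1)).exists
  have hbdd : BddAbove (cdf μ ⁻¹' Iic t) :=
    ⟨b, fun x hx ↦ ((monotone_cdf μ).reflect_lt (lt_of_le_of_lt hx hb)).le⟩
  set c := sSup (cdf μ ⁻¹' Iic t) with hc_def
  have hct : cdf μ c ≤ t := (isClosed_Iic.preimage hc).csSup_mem hne hbdd
  have heq : cdf μ ⁻¹' Iic t = Iic c :=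
    Subset.antisymm (fun x hx ↦ le_csSup hbdd hx) fun x hx ↦ (monotone_cdf μ hx).trans hct
  have htc : t ≤ cdf μ c := by
    rcases ((cdf_nonneg μ c).trans hct).eq_or_lt with h0 | h0
    · exact h0 ▸ cdf_nonneg μ c
    · obtain ⟨x, hx⟩ := hrange h0
      exact hx.symm.le.trans (monotone_cdf μ (heq.subset hx.le))
  rw [heq, ← ofReal_cdf, le_antisymm hct htc]

lemma integral_exp_two_pi_mul_I_mul_int (n : ℤ) :
    ∫ t in (0 : ℝ)..1, Complex.exp (2 * Real.pi * Complex.I * n * t) =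
      if n = 0 then 1 else 0 := by
  split_ifs with hn
  · simp [hn]
  · have hne : 2 * (Real.pi : ℂ) * Complex.I * n ≠ 0 :=
      mul_ne_zero Complex.two_pi_I_ne_zero (Int.cast_ne_zero.2 hn)
    rw [integral_exp_mul_complex hne]
    have : Complex.exp (2 * Real.pi * Complex.I * n) = 1 :=
      Complex.exp_eq_one_iff.2 ⟨n, by ring⟩
    simp [this]

open ProbabilityTheory in
lemma integral_exp_two_pi_mul_I_mul_int_mul_cdf (μ : Measure ℝ) [IsProbabilityMeasure μ]
    [NullSingletonClass μ] (n : ℤ) :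
    ∫ x, Complex.exp (2 * Real.pi * Complex.I * n * (cdf μ x : ℝ)) ∂μ =
      if n = 0 then 1 else 0 := by
  rw [← integral_exp_two_pi_mul_I_mul_int, intervalIntegral.integral_of_le zero_le_one,
    ← map_cdf_eq_restrict_volume μ, integral_map (continuous_cdf μ).aemeasurable
      (by fun_prop : Continuous fun t : ℝ ↦
        Complex.exp (2 * Real.pi * Complex.I * n * t)).aestronglyMeasurable]

/-- **Orthonormality of the phase-modulated orbitals built from a density `ρ`.**
Let `ρ : ℝ → [0, ∞)` be measurable and integrable with `N = ∫ ρ > 0`, let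
`F(x) = ∫_{-∞}^x ρ`, and for `j ∈ ℤ` set `φ_j(x) = √(ρ(x)/N) · exp((2πij/N) F(x))`.
Then `(φ_j)_{j ∈ ℤ}` is an orthonormal family in `L²(ℝ)`. -/
theorem orthonormal_density_orbitals
    (ρ : ℝ → ℝ) (hmeas : Measurable ρ) (hpos : ∀ x, 0 ≤ ρ x)
    (hint : Integrable ρ (volume : Measure ℝ))
    (N : ℝ) (hN : N = ∫ x, ρ x) (hNpos : 0 < N)
    (F : ℝ → ℝ) (hF : ∀ x, F x = ∫ t in Set.Iic x, ρ t)
    (φ : ℤ → ℝ → ℂ)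
    (hφ : ∀ j x, φ j x =
      (Real.sqrt (ρ x / N) : ℂ) *
        Complex.exp (2 * Real.pi * Complex.I * (j : ℂ) / (N : ℂ) * (F x : ℂ))) :
    ∀ j l : ℤ, (∫ x, (starRingEnd ℂ) (φ j x) * φ l x) =
      if j = l then (1 : ℂ) else 0 := by
  intro j l
  have hnonneg (x : ℝ) : 0 ≤ ρ x / N := div_nonneg (hpos x) hNpos.le
  have hdiv : Integrable (fun x ↦ ρ x / N) := hint.div_const N
  set μ : Measure ℝ := volume.withDensity fun x ↦ ENNReal.ofReal (ρ x / N) with hμ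
  have hprob : IsProbabilityMeasure μ := by
    refine ⟨?_⟩
    rw [hμ, withDensity_apply _ .univ, setLIntegral_univ,
      ← ofReal_integral_eq_lintegral_ofReal hdiv (.of_forall hnonneg), integral_div, ← hN,
      div_self hNpos.ne', ENNReal.ofReal_one]
  have hatom : NullSingletonClass μ :=
    ⟨fun x ↦ withDensity_absolutelyContinuous _ _ (measure_singleton x)⟩
  have hcdf (x : ℝ) : F x = N * ProbabilityTheory.cdf μ x := by
    rw [ProbabilityTheory.cdf_eq_real, measureReal_def, hμ, withDensity_apply _ measurableSet_Iic,
      ← ofReal_integral_eq_lintegral_ofReal hdiv.integrableOn (.of_forall hnonneg),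
      ENNReal.toReal_ofReal (integral_nonneg hnonneg), integral_div, ← hF,
      mul_div_cancel₀ _ hNpos.ne']
  have hN0 : (N : ℂ) ≠ 0 := Complex.ofReal_ne_zero.2 hNpos.ne'
  have hprod (x : ℝ) : (starRingEnd ℂ) (φ j x) * φ l x =
      (ENNReal.ofReal (ρ x / N)).toReal •
        Complex.exp (2 * Real.pi * Complex.I * ((l - j : ℤ) : ℂ) *
          (ProbabilityTheory.cdf μ x : ℝ)) := by
    rw [ENNReal.toReal_ofReal (hnonneg x), Complex.real_smul, hφ, hφ, map_mul,
      ← Complex.exp_conj, Complex.conj_ofReal, mul_mul_mul_comm, ← Complex.exp_add,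
      ← Complex.ofReal_mul, Real.mul_self_sqrt (hnonneg x), hcdf]
    congr 2
    simp only [map_mul, map_div₀, Complex.conj_ofReal, Complex.conj_I, map_intCast, map_ofNat]
    push_cast
    field_simp
    ring
  simp_rw [hprod]
  rw [← integral_withDensity_eq_integral_toReal_smul (by fun_prop)
    (.of_forall fun _ ↦ ENNReal.ofReal_lt_top), ← hμ,
    integral_exp_two_pi_mul_I_mul_int_mul_cdf μ]
  simp only [sub_eq_zero, eq_comm]
end

section
/- Define the following subsets of ℝ²: A₀ = [−5/12, 5/12)², B₀ = ([1/3, 2/3) × [−1/4, 1/4)) ∪ ([−1/4, 1/4) × [1/3, 2/3)), and C₀ = [1/6, 5/6)². Then: (i) for each I₀ ∈ {A₀, B₀, C₀} and all distinct k, j ∈ ℤ², the translates (I₀ + k) and (I₀ + j) are disjoint; and (ii) the union over all k ∈ ℤ² of (A₀ + k) ∪ (B₀ + k) ∪ (C₀ + k) is all of ℝ². -/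
open Set

/-- Every real number has an integer translate in `[c, c + 1)`. -/
lemma exists_int_sub_mem_Ico (c x : ℝ) : ∃ m : ℤ, c ≤ x - m ∧ x - m < c + 1 :=
  ⟨⌊x - c⌋, by linarith [Int.floor_le (x - c)], by linarith [Int.lt_floor_add_one (x - c)]⟩

lemma Int.eq_of_cast_sub_lt_one {m n : ℤ} (h₁ : (m : ℝ) - n < 1) (h₂ : (n : ℝ) - m < 1) :
    m = n := by
  have h₁' : m - n < 1 := by exact_mod_cast h₁
  have h₂' : n - m < 1 := by exact_mod_cast h₂
  lia

lemma Int.not_cast_sub_mem_Ioo_zero_one {m n : ℤ} (h₁ : 0 < (m : ℝ) - n) (h₂ : (m : ℝ) - n < 1) :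
    False := by
  have h₁' : 0 < m - n := by exact_mod_cast h₁
  have h₂' : m - n < 1 := by exact_mod_cast h₂
  lia

lemma mem_image_add_intCast_iff (I : Set (ℝ × ℝ)) (k : ℤ × ℤ) (p : ℝ × ℝ) :
    p ∈ (fun x : ℝ × ℝ => x + ((k.1 : ℝ), (k.2 : ℝ))) '' I ↔ (p.1 - k.1, p.2 - k.2) ∈ I := by
  rw [image_add_right, mem_preimage, ← sub_eq_add_neg]
  rfl

/-- **The three-pattern covering of the plane.**
Let `A₀ = [-5/12, 5/12)²`, `B₀ = [1/3, 2/3) × [-1/4, 1/4) ∪ [-1/4, 1/4) × [1/3, 2/3)` and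
`C₀ = [1/6, 5/6)²`.  Then (i) for each of the three sets, any two distinct `ℤ²`-translates
are disjoint, and (ii) the translates of the three sets together cover the plane `ℝ²`. -/
theorem three_pattern_covering_of_plane :
    let A₀ : Set (ℝ × ℝ) := Ico (-(5 / 12) : ℝ) (5 / 12) ×ˢ Ico (-(5 / 12) : ℝ) (5 / 12)
    let B₀ : Set (ℝ × ℝ) :=
      (Ico (1 / 3 : ℝ) (2 / 3) ×ˢ Ico (-(1 / 4) : ℝ) (1 / 4)) ∪
        (Ico (-(1 / 4) : ℝ) (1 / 4) ×ˢ Ico (1 / 3 : ℝ) (2 / 3))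
    let C₀ : Set (ℝ × ℝ) := Ico (1 / 6 : ℝ) (5 / 6) ×ˢ Ico (1 / 6 : ℝ) (5 / 6)
    let translate : Set (ℝ × ℝ) → ℤ × ℤ → Set (ℝ × ℝ) :=
      fun I k => (fun x : ℝ × ℝ => x + ((k.1 : ℝ), (k.2 : ℝ))) '' I
    (∀ I₀ ∈ ({A₀, B₀, C₀} : Set (Set (ℝ × ℝ))), ∀ k j : ℤ × ℤ, k ≠ j →
        Disjoint (translate I₀ k) (translate I₀ j)) ∧
    (⋃ k : ℤ × ℤ, (translate A₀ k ∪ translate B₀ k ∪ translate C₀ k)) = univ := by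
  intro A₀ B₀ C₀ translate
  refine ⟨fun I₀ hI₀ k j hkj => ?_, eq_univ_of_forall fun p => ?_⟩
  · refine Set.disjoint_left.2 fun p hk hj => hkj ?_
    simp only [translate, mem_image_add_intCast_iff] at hk hj
    rcases hI₀ with rfl | rfl | rfl
    · simp only [A₀, mem_prod, mem_Ico] at hk hj
      ext <;> apply Int.eq_of_cast_sub_lt_one <;> linarith
    · simp only [B₀, mem_union, mem_prod, mem_Ico] at hk hj
      rcases hk with hk | hk <;> rcases hj with hj | hj
      · ext <;> apply Int.eq_of_cast_sub_lt_one <;> linarith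
      · exact (Int.not_cast_sub_mem_Ioo_zero_one (m := j.1) (n := k.1)
          (by linarith) (by linarith)).elim
      · exact (Int.not_cast_sub_mem_Ioo_zero_one (m := k.1) (n := j.1)
          (by linarith) (by linarith)).elim
      · ext <;> apply Int.eq_of_cast_sub_lt_one <;> linarith
    · simp only [C₀, mem_prod, mem_Ico] at hk hj
      ext <;> apply Int.eq_of_cast_sub_lt_one <;> linarith
  · simp only [translate, mem_iUnion, mem_union, mem_image_add_intCast_iff, A₀, B₀, C₀, mem_prod,
      mem_Ico]
    obtain ⟨m, hm⟩ := exists_int_sub_mem_Ico (-(5 / 12)) p.1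
    obtain ⟨n, hn⟩ := exists_int_sub_mem_Ico (-(5 / 12)) p.2
    rcases lt_or_ge (p.1 - m) (5 / 12) with hx | hx
    · rcases lt_or_ge (p.2 - n) (5 / 12) with hy | hy
      · exact ⟨(m, n), .inl (.inl ⟨⟨hm.1, hx⟩, hn.1, hy⟩)⟩
      · obtain ⟨m', hm'⟩ := exists_int_sub_mem_Ico (-(1 / 4)) p.1
        refine ⟨(m', n), ?_⟩
        rcases lt_or_ge (p.1 - m') (1 / 4) with h | h
        · exact .inl (.inr (.inr ⟨⟨hm'.1, h⟩, by linarith, by linarith⟩))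
        · exact .inr ⟨⟨by linarith, by linarith⟩, by linarith, by linarith⟩
    · obtain ⟨n', hn'⟩ := exists_int_sub_mem_Ico (-(1 / 4)) p.2
      refine ⟨(m, n'), ?_⟩
      rcases lt_or_ge (p.2 - n') (1 / 4) with h | h
      · exact .inl (.inr (.inl ⟨⟨by linarith, by linarith⟩, hn'.1, h⟩))
      · exact .inr ⟨⟨by linarith, by linarith⟩, by linarith, by linarith⟩
end
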